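/- Fix an integer K ≥ 2 and a real ρ_V > 0. Let r : (0,∞) → ℝ be a function such that for every a > 0 one has 0 ≤ r(a) < a and f_a(ρ_V, r(a)) = 0. Then, as a → ∞: (i) r(a)/√a → √(K·ρ_V); (ii) √a·(K − s̃(ρ_V, r(a))) → √(K/ρ_V); and (iii) a·(1 − P_b(ρ_V, r(a))) → K − 1. -/

import Mathlib

open Finset

/-- Partition function `Z(ρ_V, ρ_R) = Σ_{k+l ≤ K} ρ_V^k ρ_R^l / l!`. -/
noncomputable def Z (K : ℕ) (x r : ℝ) : ℝ :=
  ∑ k ∈ Finset.range (K + 1), ∑ l ∈ Finset.range (K + 1 - k),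
    x ^ k * r ^ l / (Nat.factorial l : ℝ)

/-- Stationary probability `π_{k,l}`. -/
noncomputable def piP (K : ℕ) (x r : ℝ) (k l : ℕ) : ℝ :=
  x ^ k * r ^ l / ((Nat.factorial l : ℝ) * Z K x r)

/-- `π_{0,·}` : probability of an empty station (no vehicles). -/
noncomputable def piZero (K : ℕ) (x r : ℝ) : ℝ :=
  ∑ l ∈ Finset.range (K + 1), piP K x r 0 l

/-- `π_S` : probability of a saturated station. -/
noncomputable def piSat (K : ℕ) (x r : ℝ) : ℝ :=
  ∑ k ∈ Finset.range (K + 1), piP K x r k (K - k)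

/-- Mean occupancy `s̃(ρ_V,ρ_R)`. -/
noncomputable def sTilde (K : ℕ) (x r : ℝ) : ℝ :=
  (∑ k ∈ Finset.range (K + 1), ∑ l ∈ Finset.range (K + 1 - k),
    ((k : ℝ) + (l : ℝ)) * (x ^ k * r ^ l / (Nat.factorial l : ℝ))) / Z K x r

/-- `f(ρ_V,ρ_R) = (a − ρ_R)·Z(ρ_V,ρ_R) − a·Σ_{l=0}^K ρ_R^l/l!`. -/
noncomputable def fEq (K : ℕ) (a x r : ℝ) : ℝ :=
  (a - r) * Z K x r - a * ∑ l ∈ Finset.range (K + 1), r ^ l / (Nat.factorial l : ℝ)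

/-- Proportion of problematic stations `P_b`. -/
noncomputable def Pb (K : ℕ) (x r : ℝ) : ℝ :=
  piZero K x r + piSat K x r - piP K x r 0 K

/-- Upper bound `P_b^+`. -/
noncomputable def PbPlus (K : ℕ) (x r : ℝ) : ℝ :=
  piZero K x r + piSat K x r

open Filter Topology

/-- The weighted sum `Σ_{k+l ≤ K} c_{k,l} x^k r^l / l!`. -/
noncomputable def weightedSum (K : ℕ) (c : ℕ → ℕ → ℝ) (x r : ℝ) : ℝ :=
  ∑ k ∈ Finset.range (K + 1), ∑ l ∈ Finset.range (K + 1 - k),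
    c k l * (x ^ k * r ^ l / (Nat.factorial l : ℝ))

theorem tendsto_const_mul_pow_div_pow {a : ℝ} {l n : ℕ} (h : n < l → a = 0) :
    Tendsto (fun r : ℝ => a * r ^ l / r ^ n) atTop (𝓝 (if l = n then a else 0)) := by
  rcases lt_trichotomy l n with hl | rfl | hl
  · rw [if_neg hl.ne]
    have := (tendsto_pow_div_pow_atTop_zero (𝕜 := ℝ) hl).const_mul a
    simpa [mul_div_assoc] using this
  · rw [if_pos rfl]
    refine tendsto_const_nhds.congr' ?_
    filter_upwards [eventually_gt_atTop 0] with r hr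
    field_simp
  · simp [h hl]

theorem tendsto_weightedSum_div_pow {K n : ℕ} {c : ℕ → ℕ → ℝ} (x : ℝ) (hn : n ≤ K)
    (hc : ∀ k l, k + l ≤ K → n < l → c k l = 0) :
    Tendsto (fun r => weightedSum K c x r / r ^ n) atTop
      (𝓝 (∑ k ∈ Finset.range (K + 1 - n), c k n * (x ^ k / (Nat.factorial n : ℝ)))) := by
  have key : Tendsto (fun r : ℝ => ∑ k ∈ Finset.range (K + 1), ∑ l ∈ Finset.range (K + 1 - k),
      (c k l * (x ^ k / (Nat.factorial l : ℝ))) * r ^ l / r ^ n) atTop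
      (𝓝 (∑ k ∈ Finset.range (K + 1), ∑ l ∈ Finset.range (K + 1 - k),
        if l = n then c k l * (x ^ k / (Nat.factorial l : ℝ)) else 0)) := by
    refine tendsto_finsetSum _ fun k hk => tendsto_finsetSum _ fun l hl => ?_
    rw [Finset.mem_range] at hk hl
    exact tendsto_const_mul_pow_div_pow fun h => by rw [hc k l (by omega) h, zero_mul]
  convert key using 2
  · simp only [weightedSum, Finset.sum_div]
    refine Finset.sum_congr rfl fun k _ => Finset.sum_congr rfl fun l _ => ?_
    ring
  · simp only [Finset.sum_ite_eq', ← Finset.sum_filter]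
    refine Finset.sum_congr ?_ fun _ _ => rfl
    ext k
    simp only [Finset.mem_range, Finset.mem_filter]
    omega

theorem Z_eq_weightedSum (K : ℕ) (x r : ℝ) : Z K x r = weightedSum K (fun _ _ => 1) x r := by
  simp [Z, weightedSum]

theorem tendsto_pow_mul_weightedSum_div_Z {K m n : ℕ} {c : ℕ → ℕ → ℝ} (x : ℝ) (hn : m + n = K)
    (hc : ∀ k l, k + l ≤ K → n < l → c k l = 0) :
    Tendsto (fun r => r ^ m * weightedSum K c x r / Z K x r) atTop
      (𝓝 ((∑ k ∈ Finset.range (m + 1), c k n * (x ^ k / (Nat.factorial n : ℝ))) *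
        (Nat.factorial K : ℝ))) := by
  have h₁ := tendsto_weightedSum_div_pow (K := K) (n := n) x (by omega) hc
  have h₂ := tendsto_weightedSum_div_pow (K := K) (n := K) (c := fun _ _ => 1) x le_rfl
    (fun k l _ _ => by omega)
  have h₃ := h₁.div h₂ (by simp [Nat.factorial_ne_zero])
  rw [show K + 1 - n = m + 1 by omega] at h₃
  convert h₃.congr' ?_ using 2
  · simp
  · filter_upwards [eventually_gt_atTop 0] with r hr
    simp only [Pi.div_apply, ← Z_eq_weightedSum]
    rw [← hn, pow_add]
    field_simp

theorem Z_pos {K : ℕ} {x r : ℝ} (hx : 0 < x) (hr : 0 ≤ r) : 0 < Z K x r := by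
  refine Finset.sum_pos' (fun k _ => Finset.sum_nonneg fun l _ => by positivity)
    ⟨0, by simp, Finset.sum_pos' (fun l _ => by positivity) ⟨0, by simp, by simp⟩⟩

theorem sum_range_eq_weightedSum (K : ℕ) (x r : ℝ) :
    ∑ l ∈ Finset.range (K + 1), r ^ l / (Nat.factorial l : ℝ) =
      weightedSum K (fun k _ => if k = 0 then 1 else 0) x r := by
  symm
  rw [weightedSum, Finset.sum_eq_single 0]
  · simp
  · intro k _ hk
    simp [hk]
  · simp

theorem sum_diagonal_eq_weightedSum (K : ℕ) (x r : ℝ) :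
    ∑ k ∈ Finset.range (K + 1), x ^ k * r ^ (K - k) / (Nat.factorial (K - k) : ℝ) =
      weightedSum K (fun k l => if k + l = K then 1 else 0) x r := by
  refine Finset.sum_congr rfl fun k hk => ?_
  rw [Finset.mem_range] at hk
  rw [Finset.sum_eq_single (K - k)]
  · simp only [if_pos (show k + (K - k) = K by omega), one_mul]
  · intro l _ hl
    simp only [if_neg (show k + l ≠ K by omega), zero_mul]
  · intro h
    simp only [Finset.mem_range] at h
    omega

theorem corner_eq_weightedSum (K : ℕ) (x r : ℝ) :
    r ^ K / (Nat.factorial K : ℝ) =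
      weightedSum K (fun k l => if k = 0 ∧ k + l = K then 1 else 0) x r := by
  rw [weightedSum, Finset.sum_eq_single 0, Finset.sum_eq_single K]
  · simp
  · intro l _ hl
    simp [hl]
  · simp
  · intro k _ hk
    simp [hk]
  · simp

theorem weightedSum_sub (K : ℕ) (c d : ℕ → ℕ → ℝ) (x r : ℝ) :
    weightedSum K c x r - weightedSum K d x r = weightedSum K (fun k l => c k l - d k l) x r := by
  simp only [weightedSum, ← Finset.sum_sub_distrib, sub_mul]

theorem weightedSum_add (K : ℕ) (c d : ℕ → ℕ → ℝ) (x r : ℝ) :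
    weightedSum K c x r + weightedSum K d x r = weightedSum K (fun k l => c k l + d k l) x r := by
  simp only [weightedSum, ← Finset.sum_add_distrib, add_mul]

/-- The equilibrium equation says `a` times the weight of the nonempty stations is `r Z`. -/
theorem fEq_eq (K : ℕ) (a x r : ℝ) :
    fEq K a x r = a * weightedSum K (fun k _ => if k = 0 then 0 else 1) x r - r * Z K x r := by
  have h := weightedSum_sub K (fun _ _ => 1) (fun k _ => if k = 0 then 1 else 0) x r
  have h' : (fun k _ => (1 : ℝ) - if k = 0 then 1 else 0) =
      (fun k _ => if k = 0 then 0 else 1 : ℕ → ℕ → ℝ) := by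
    ext k l
    split_ifs <;> simp
  rw [h', ← Z_eq_weightedSum, ← sum_range_eq_weightedSum] at h
  rw [← h, fEq]
  ring

theorem sub_sTilde_eq (K : ℕ) {x r : ℝ} (hZ : Z K x r ≠ 0) :
    (K : ℝ) - sTilde K x r = weightedSum K (fun k l => (K : ℝ) - (k + l)) x r / Z K x r := by
  rw [eq_div_iff hZ, sTilde, sub_mul, div_mul_cancel₀ _ hZ]
  simp only [Z, weightedSum, sub_mul, Finset.sum_sub_distrib, Finset.mul_sum]

theorem one_sub_Pb_eq (K : ℕ) {x r : ℝ} (hZ : Z K x r ≠ 0) :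
    1 - Pb K x r =
      weightedSum K (fun k l => if k = 0 ∨ k + l = K then 0 else 1) x r / Z K x r := by
  have h : 1 - Pb K x r = (Z K x r - ∑ l ∈ Finset.range (K + 1), r ^ l / (Nat.factorial l : ℝ) -
      ∑ k ∈ Finset.range (K + 1), x ^ k * r ^ (K - k) / (Nat.factorial (K - k) : ℝ) +
      r ^ K / (Nat.factorial K : ℝ)) / Z K x r := by
    simp only [Pb, piZero, piSat, piP, pow_zero, one_mul, ← div_div, ← Finset.sum_div]
    field_simp
    ring
  rw [h, Z_eq_weightedSum, sum_range_eq_weightedSum K x r, sum_diagonal_eq_weightedSum,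
    corner_eq_weightedSum K x r, weightedSum_sub, weightedSum_sub, weightedSum_add]
  congr 2
  ext k l
  by_cases h₁ : k = 0 <;> by_cases h₂ : k + l = K <;> simp [h₁, h₂]

theorem le_weightedSum_nonempty {K : ℕ} (hK : 1 ≤ K) {x r : ℝ} (hx : 0 < x) (hr : 0 ≤ r) :
    x ≤ weightedSum K (fun k _ => if k = 0 then 0 else 1) x r := by
  have hterm : ∀ k l : ℕ,
      0 ≤ (if k = 0 then (0 : ℝ) else 1) * (x ^ k * r ^ l / (Nat.factorial l : ℝ)) := by
    intro k l
    split_ifs <;> simp only [zero_mul, one_mul, le_refl]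
    positivity
  calc x = (if (1 : ℕ) = 0 then (0 : ℝ) else 1) * (x ^ 1 * r ^ 0 / (Nat.factorial 0 : ℝ)) := by
        simp
    _ ≤ ∑ l ∈ Finset.range (K + 1 - 1),
        (if (1 : ℕ) = 0 then (0 : ℝ) else 1) * (x ^ 1 * r ^ l / (Nat.factorial l : ℝ)) :=
      Finset.single_le_sum (f := fun l => (if (1 : ℕ) = 0 then (0 : ℝ) else 1) *
        (x ^ 1 * r ^ l / (Nat.factorial l : ℝ))) (fun l _ => hterm 1 l)
        (Finset.mem_range.2 (by omega))
    _ ≤ _ := Finset.single_le_sum (f := fun k => ∑ l ∈ Finset.range (K + 1 - k),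
        (if k = 0 then (0 : ℝ) else 1) * (x ^ k * r ^ l / (Nat.factorial l : ℝ)))
        (fun k _ => Finset.sum_nonneg fun l _ => hterm k l) (Finset.mem_range.2 (by omega))

theorem Z_mono {K : ℕ} {x r s : ℝ} (hx : 0 ≤ x) (hr : 0 ≤ r) (hrs : r ≤ s) :
    Z K x r ≤ Z K x s := by
  unfold Z
  gcongr

theorem tendsto_atTop_of_fEq_eq_zero {K : ℕ} (hK : 1 ≤ K) {x : ℝ} (hx : 0 < x) {r : ℝ → ℝ}
    (hr : ∀ a : ℝ, 0 < a → 0 ≤ r a ∧ fEq K a x (r a) = 0) : Tendsto r atTop atTop := by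
  refine tendsto_atTop.2 fun M => ?_
  filter_upwards [eventually_gt_atTop 0, eventually_gt_atTop (M * Z K x M / x)] with a ha haM
  obtain ⟨h₀, hf⟩ := hr a ha
  by_contra! hlt
  rw [fEq_eq, sub_eq_zero] at hf
  have h₁ : a * x ≤ r a * Z K x (r a) := by
    rw [← hf]
    exact mul_le_mul_of_nonneg_left (le_weightedSum_nonempty hK hx h₀) ha.le
  have h₂ : r a * Z K x (r a) ≤ M * Z K x M :=
    mul_le_mul hlt.le (Z_mono hx.le h₀ hlt.le) (Z_pos hx h₀).le (h₀.trans hlt.le)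
  rw [div_lt_iff₀ hx] at haM
  linarith

/-- Heavy-traffic asymptotics: as a → ∞, the equilibrium quantities satisfy
r(a)/√a → √(Kx), √a·(K − s̃) → √(K/x), and a·(1 − Pb) → K − 1. -/
theorem stmt_19 (K : ℕ) (hK : 2 ≤ K) (x : ℝ) (hx : 0 < x)
    (r : ℝ → ℝ) (hr : ∀ a : ℝ, 0 < a → 0 ≤ r a ∧ r a < a ∧ fEq K a x (r a) = 0) :
    Filter.Tendsto (fun a => r a / Real.sqrt a) Filter.atTop
      (nhds (Real.sqrt ((K : ℝ) * x)))
    ∧ Filter.Tendsto (fun a => Real.sqrt a * ((K : ℝ) - sTilde K x (r a)))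
      Filter.atTop (nhds (Real.sqrt ((K : ℝ) / x)))
    ∧ Filter.Tendsto (fun a => a * (1 - Pb K x (r a))) Filter.atTop
      (nhds ((K : ℝ) - 1)) := by
  obtain ⟨m, rfl⟩ : ∃ m, K = m + 2 := ⟨K - 2, by omega⟩
  have hr_top : Tendsto r atTop atTop :=
    tendsto_atTop_of_fEq_eq_zero (by omega) hx fun a ha => ⟨(hr a ha).1, (hr a ha).2.2⟩
  have hm : (Nat.factorial m : ℝ) ≠ 0 := by exact_mod_cast Nat.factorial_ne_zero m
  have hratio : Tendsto (fun a => r a ^ 2 / a) atTop (𝓝 (((m + 2 : ℕ) : ℝ) * x)) := by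
    have h := (tendsto_pow_mul_weightedSum_div_Z (K := m + 2) (m := 1) (n := m + 1)
      (c := fun k _ => if k = 0 then 0 else 1) x (by omega)
      (fun k l h₁ h₂ => if_pos (by omega))).comp hr_top
    convert h.congr' ?_ using 2
    · simp [Finset.sum_range_succ, Nat.factorial_succ]
      field_simp
      ring
    · filter_upwards [eventually_gt_atTop 0] with a ha
      obtain ⟨h₀, -, hf⟩ := hr a ha
      have hZ := (Z_pos (K := m + 2) hx h₀).ne'
      rw [fEq_eq, sub_eq_zero] at hf
      rw [Function.comp_apply, pow_one, div_eq_div_iff hZ ha.ne']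
      linear_combination r a * hf
  have hocc := (tendsto_pow_mul_weightedSum_div_Z (K := m + 2) (m := 1) (n := m + 1)
    (c := fun k l => ((m + 2 : ℕ) : ℝ) - (k + l)) x (by omega) (fun k l h₁ h₂ => by
      obtain rfl : k = 0 := by omega
      obtain rfl : l = m + 2 := by omega
      simp)).comp hr_top
  have hprob := (tendsto_pow_mul_weightedSum_div_Z (K := m + 2) (m := 2) (n := m)
    (c := fun k l => if k = 0 ∨ k + l = m + 2 then 0 else 1) x (by omega)
    (fun k l h₁ h₂ => if_pos (by omega))).comp hr_top
  have hKx : 0 < ((m + 2 : ℕ) : ℝ) * x := by positivity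
  have hroot : Tendsto (fun a => r a / Real.sqrt a) atTop
      (𝓝 (Real.sqrt (((m + 2 : ℕ) : ℝ) * x))) := by
    refine hratio.sqrt.congr' ?_
    filter_upwards [eventually_gt_atTop 0] with a ha
    rw [Real.sqrt_div (sq_nonneg _), Real.sqrt_sq (hr a ha).1]
  refine ⟨hroot, ?_, ?_⟩
  · convert (hocc.div hroot (Real.sqrt_pos.2 hKx).ne').congr' ?_ using 2
    · rw [eq_div_iff (Real.sqrt_pos.2 hKx).ne', ← Real.sqrt_mul (by positivity),
        show ((m + 2 : ℕ) : ℝ) / x * (((m + 2 : ℕ) : ℝ) * x) = ((m + 2 : ℕ) : ℝ) ^ 2 by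
          field_simp, Real.sqrt_sq (by positivity)]
      simp [Finset.sum_range_succ, Nat.factorial_succ]
      field_simp
      ring
    · filter_upwards [eventually_gt_atTop 0, hr_top.eventually_gt_atTop 0] with a ha hra
      have hZ := (Z_pos (K := m + 2) hx hra.le).ne'
      have hs := (Real.sqrt_pos.2 ha).ne'
      rw [sub_sTilde_eq _ hZ]
      simp only [Pi.div_apply, Function.comp_apply]
      field_simp
  · convert (hprob.div hratio hKx.ne').congr' ?_ using 2
    · simp [Finset.sum_range_succ, Nat.factorial_succ,
        show 1 + m ≠ m + 2 by omega, add_comm 2 m]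
      field_simp
      ring
    · filter_upwards [eventually_gt_atTop 0, hr_top.eventually_gt_atTop 0] with a ha hra
      have hZ := (Z_pos (K := m + 2) hx hra.le).ne'
      rw [one_sub_Pb_eq _ hZ]
      simp only [Pi.div_apply, Function.comp_apply]
      field_simp
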